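/- A random bipartite graph with parameters n, k, d = log(n−k) + 2log(1/ε) + O(1) and m = k + d − 2log(1/ε) − O(1) is a (k, ε)-extractor with positive probability; in particular, for all n, k < n and ε > 0 there exists a (k, ε)-extractor with these parameters. -/

import Mathlib

open scoped Classical

/-- Number of edges from the left-subset `S` into the right-subset `Y`. -/
noncomputable def edges {L R : Type*} {D : ℕ}
    (nbr : L → Fin D → R) (S : Finset L) (Y : Finset R) : ℕ :=
  ∑ x ∈ S, (Finset.univ.filter fun i => nbr x i ∈ Y).card

/-- `(k, ε)`-extractor property for a bipartite multigraph with left part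
`{0,1}^n`, right part `{0,1}^m` and left-degree `D = 2^d`. -/
noncomputable def IsExtractor {n m d : ℕ} (nbr : Fin (2^n) → Fin (2^d) → Fin (2^m))
    (k : ℕ) (ε : ℝ) : Prop :=
  ∀ S : Finset (Fin (2^n)), 2^k ≤ S.card →
    ∀ Y : Finset (Fin (2^m)),
      |(edges nbr S Y : ℝ) / ((2^d : ℕ) * S.card) - (Y.card : ℝ) / (2^m : ℕ)| < ε

/-- The `α`-clot of `S` with parameter `K = 2^k`: right vertices receiving more
than `α·D·K/M` edges from `S`. -/
noncomputable def clot {n m d : ℕ} (nbr : Fin (2^n) → Fin (2^d) → Fin (2^m))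
    (S : Finset (Fin (2^n))) (k : ℕ) (α : ℝ) : Finset (Fin (2^m)) :=
  Finset.univ.filter fun y =>
    α * (2^d : ℕ) * (2^k : ℕ) / (2^m : ℕ) < (edges nbr S {y} : ℝ)

/-- Moment generating function bound for a centred indicator variable. -/
lemma sum_exp_indicator_le {R : Type*} [Fintype R] [Nonempty R] (Y : Finset R) {l : ℝ}
    (hl : |l| ≤ 1) :
    ∑ y : R, Real.exp (l * ((if y ∈ Y then 1 else 0) - (Y.card : ℝ) / Fintype.card R))
      ≤ Fintype.card R * Real.exp (l ^ 2) := by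
  have hR : (0 : ℝ) < Fintype.card R := by exact_mod_cast Fintype.card_pos
  set p : ℝ := (Y.card : ℝ) / Fintype.card R with hp
  have hp0 : 0 ≤ p := by positivity
  have hp1 : p ≤ 1 := by
    rw [hp, div_le_one hR]
    exact_mod_cast Finset.card_le_univ Y
  have hterm : ∀ y : R, Real.exp (l * ((if y ∈ Y then 1 else 0) - p)) ≤
      1 + l * ((if y ∈ Y then 1 else 0) - p) + l ^ 2 := by
    intro y
    have hb : |(if y ∈ Y then (1 : ℝ) else 0) - p| ≤ 1 := by
      rw [abs_le]
      split_ifs <;> constructor <;> linarith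
    have hu : |l * ((if y ∈ Y then (1 : ℝ) else 0) - p)| ≤ |l| := by
      rw [abs_mul]
      exact mul_le_of_le_one_right (abs_nonneg l) hb
    have h1 := (abs_le.mp (Real.abs_exp_sub_one_sub_id_le (hu.trans hl))).2
    have h2 := sq_le_sq.mpr hu
    linarith
  have hmean : ∑ y : R, ((if y ∈ Y then (1 : ℝ) else 0) - p) = 0 := by
    rw [Finset.sum_sub_distrib]
    simp [hp]
    field_simp
    simp
  calc _ ≤ ∑ y : R, (1 + l * ((if y ∈ Y then 1 else 0) - p) + l ^ 2) :=
        Finset.sum_le_sum fun y _ => hterm y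
    _ = Fintype.card R * (l ^ 2 + 1) := by
        rw [Finset.sum_add_distrib, Finset.sum_add_distrib, ← Finset.mul_sum, hmean]
        simp
        ring
    _ ≤ _ := by gcongr; exact Real.add_one_le_exp _

/-- Moment generating function bound for the number of edges from `S` to `Y` in a random graph. -/
lemma sum_exp_edges_le {L R : Type*} [Fintype L] [DecidableEq L] [Fintype R] [Nonempty R] {D : ℕ}
    (S : Finset L) (Y : Finset R) {l : ℝ} (hl : |l| ≤ 1) :
    ∑ f : L → Fin D → R,
        Real.exp (l * ((edges f S Y : ℝ) - (Y.card : ℝ) / Fintype.card R * (D * S.card)))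
      ≤ Fintype.card (L → Fin D → R) * Real.exp (l ^ 2 * (D * S.card)) := by
  set p : ℝ := (Y.card : ℝ) / Fintype.card R with hp
  have hexp : ∀ f : L → Fin D → R, Real.exp (l * ((edges f S Y : ℝ) - p * (D * S.card))) =
      ∏ x : L, ∏ i : Fin D,
        if x ∈ S then Real.exp (l * ((if f x i ∈ Y then 1 else 0) - p)) else 1 := by
    intro f
    have h1 : l * ((edges f S Y : ℝ) - p * (D * S.card)) =
        ∑ x ∈ S, ∑ i : Fin D, l * ((if f x i ∈ Y then 1 else 0) - p) := by
      simp only [← Finset.mul_sum, Finset.sum_sub_distrib]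
      congr 1
      simp [edges]
      ring
    rw [h1, Real.exp_sum, ← Finset.prod_filter_mul_prod_filter_not Finset.univ (· ∈ S)]
    rw [Finset.prod_eq_one (s := Finset.univ.filter fun x => x ∉ S), mul_one]
    · rw [Finset.filter_univ_mem]
      refine Finset.prod_congr rfl fun x hx => ?_
      simp [hx, Real.exp_sum]
    · intro x hx
      simp [(Finset.mem_filter.mp hx).2]
  have hsum : ∀ g : L → R → ℝ, ∑ f : L → Fin D → R, ∏ x : L, ∏ i : Fin D, g x (f x i) =
      ∏ x : L, (∑ y : R, g x y) ^ D := by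
    intro g
    have h2 := Finset.prod_univ_sum (fun _ : L => (Finset.univ : Finset (Fin D → R)))
      (fun x h => ∏ i : Fin D, g x (h i))
    rw [Fintype.piFinset_univ] at h2
    rw [← h2]
    refine Finset.prod_congr rfl fun x _ => ?_
    have h3 := Finset.prod_univ_sum (fun _ : Fin D => (Finset.univ : Finset R))
      (fun _ y => g x y)
    rw [Fintype.piFinset_univ] at h3
    rw [← h3]
    simp
  simp only [hexp]
  rw [hsum fun x y => if x ∈ S then Real.exp (l * ((if y ∈ Y then 1 else 0) - p)) else 1]
  calc _ ≤ ∏ x : L, ((Fintype.card R : ℝ) * if x ∈ S then Real.exp (l ^ 2) else 1) ^ D := by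
        refine Finset.prod_le_prod (fun x _ => ?_) fun x _ => ?_
        · refine pow_nonneg (Finset.sum_nonneg fun y _ => ?_) _
          split_ifs <;> positivity
        · refine pow_le_pow_left₀ (Finset.sum_nonneg fun y _ => ?_) ?_ _
          · split_ifs <;> positivity
          · by_cases hx : x ∈ S
            · simpa only [hx, if_true] using sum_exp_indicator_le Y hl
            · simp [hx]
    _ = _ := by
        rw [Finset.prod_pow, Finset.prod_mul_distrib, Finset.prod_ite_mem]
        simp only [Finset.univ_inter, Finset.prod_const, Finset.card_univ, Fintype.card_fun,
          Fintype.card_fin, Nat.cast_pow]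
        rw [mul_pow, ← Real.exp_nat_mul, ← Real.exp_nat_mul, pow_right_comm]
        congr 2
        ring

/-- Chernoff-type bound for the weighted number of large subsets. -/
lemma sum_pow_card_le {ι : Type*} [Fintype ι] {x t : ℝ} (hx : 0 ≤ x) (ht : 1 ≤ t) (K : ℕ) :
    ∑ S : Finset ι with K ≤ S.card, x ^ S.card ≤ Real.exp (x * t * Fintype.card ι) / t ^ K := by
  have ht0 : 0 < t := by linarith
  rw [le_div_iff₀ (by positivity), Finset.sum_mul]
  calc _ ≤ ∑ S : Finset ι with K ≤ S.card, (x * t) ^ S.card := by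
        refine Finset.sum_le_sum fun S hS => ?_
        rw [mul_pow]
        gcongr
        exact (Finset.mem_filter.mp hS).2
    _ ≤ ∑ S : Finset ι, (x * t) ^ S.card :=
        Finset.sum_le_sum_of_subset_of_nonneg (Finset.filter_subset _ _)
          fun _ _ _ => by positivity
    _ = (x * t + 1) ^ Fintype.card ι := by
        simpa using Fintype.sum_pow_mul_eq_add_pow ι (x * t) 1
    _ ≤ Real.exp (x * t) ^ Fintype.card ι := by
        gcongr
        exact Real.add_one_le_exp _
    _ = _ := by rw [← Real.exp_nat_mul, mul_comm]

/-- The union bound: if the total failure weight is below `1`, an extractor exists. -/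
lemma exists_isExtractor_of_sum_lt_one {n m d k : ℕ} {ε : ℝ} (hε : 0 < ε) (hε1 : ε ≤ 1)
    (h : (2 : ℝ) ^ (2 ^ m) * 2 * ∑ S : Finset (Fin (2 ^ n)) with 2 ^ k ≤ S.card,
      Real.exp (-(ε ^ 2 * 2 ^ d / 4)) ^ S.card < 1) :
    ∃ nbr : Fin (2 ^ n) → Fin (2 ^ d) → Fin (2 ^ m), IsExtractor nbr k ε := by
  by_contra! hbad
  set Z : (Fin (2 ^ n) → Fin (2 ^ d) → Fin (2 ^ m)) → Finset (Fin (2 ^ n)) →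
      Finset (Fin (2 ^ m)) → ℝ := fun f S Y =>
    (edges f S Y : ℝ) - (Y.card : ℝ) / Fintype.card (Fin (2 ^ m)) * ((2 ^ d : ℕ) * S.card) with hZ
  set w : (Fin (2 ^ n) → Fin (2 ^ d) → Fin (2 ^ m)) → Finset (Fin (2 ^ n)) →
      Finset (Fin (2 ^ m)) → ℝ := fun f S Y =>
    Real.exp (-(ε ^ 2 / 2 * ((2 ^ d : ℕ) * S.card))) *
      (Real.exp (ε / 2 * Z f S Y) + Real.exp (-(ε / 2) * Z f S Y)) with hw
  have hw0 : ∀ f S Y, 0 ≤ w f S Y := fun f S Y => by positivity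
  have hlow : ∀ f, 1 ≤ ∑ S : Finset (Fin (2 ^ n)) with 2 ^ k ≤ S.card, ∑ Y, w f S Y := by
    intro f
    have hf := hbad f
    simp only [IsExtractor, not_forall, not_lt] at hf
    obtain ⟨S, hS, Y, hY⟩ := hf
    have hS0 : 0 < (S.card : ℝ) := by
      exact_mod_cast lt_of_lt_of_le (by positivity) hS
    have hT : 0 < ((2 ^ d : ℕ) * S.card : ℝ) := by positivity
    have hZe : (edges f S Y : ℝ) / ((2 ^ d : ℕ) * S.card) - (Y.card : ℝ) / (2 ^ m : ℕ) =
        Z f S Y / ((2 ^ d : ℕ) * S.card) := by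
      simp only [hZ, Fintype.card_fin]
      rw [sub_div, mul_div_cancel_right₀ _ hT.ne']
    rw [hZe, abs_div, abs_of_pos hT, le_div_iff₀ hT] at hY
    have hone : 1 ≤ w f S Y := by
      simp only [hw]
      rw [mul_add, ← Real.exp_add, ← Real.exp_add]
      rcases le_abs.mp hY with hpos | hneg
      · refine le_add_of_le_of_nonneg (Real.one_le_exp ?_) (Real.exp_pos _).le
        nlinarith
      · refine le_add_of_nonneg_of_le (Real.exp_pos _).le (Real.one_le_exp ?_)
        nlinarith
    calc 1 ≤ w f S Y := hone
      _ ≤ ∑ Y, w f S Y :=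
        Finset.single_le_sum (f := fun Y => w f S Y) (fun Y _ => hw0 f S Y) (Finset.mem_univ Y)
      _ ≤ _ := Finset.single_le_sum (f := fun S => ∑ Y, w f S Y)
        (fun S _ => Finset.sum_nonneg fun Y _ => hw0 f S Y) (by simpa using hS)
  set F : ℝ := (Fintype.card (Fin (2 ^ n) → Fin (2 ^ d) → Fin (2 ^ m)) : ℝ) with hF
  have hF0 : 0 < F := by
    rw [hF]
    exact_mod_cast Fintype.card_pos
  have hup : ∀ S Y, ∑ f, w f S Y ≤ F * (2 * Real.exp (-(ε ^ 2 * 2 ^ d / 4)) ^ S.card) := by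
    intro S Y
    have hl : |ε / 2| ≤ 1 := by
      rw [abs_of_pos (by positivity)]
      linarith
    have h1 := sum_exp_edges_le (D := 2 ^ d) S Y hl
    have h2 := sum_exp_edges_le (D := 2 ^ d) S Y (l := -(ε / 2)) (by rwa [abs_neg])
    rw [neg_sq] at h2
    simp only [hw]
    rw [← Finset.mul_sum, Finset.sum_add_distrib]
    calc _ ≤ Real.exp (-(ε ^ 2 / 2 * ((2 ^ d : ℕ) * S.card))) *
          (F * Real.exp ((ε / 2) ^ 2 * ((2 ^ d : ℕ) * S.card)) +
            F * Real.exp ((ε / 2) ^ 2 * ((2 ^ d : ℕ) * S.card))) := by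
          gcongr
      _ = F * (2 * (Real.exp (-(ε ^ 2 / 2 * ((2 ^ d : ℕ) * S.card))) *
            Real.exp ((ε / 2) ^ 2 * ((2 ^ d : ℕ) * S.card)))) := by ring
      _ = _ := by
          rw [← Real.exp_add, ← Real.exp_nat_mul]
          congr 3
          push_cast
          ring
  have htotal : F ≤ F * ((2 : ℝ) ^ (2 ^ m) * 2 *
      ∑ S : Finset (Fin (2 ^ n)) with 2 ^ k ≤ S.card,
        Real.exp (-(ε ^ 2 * 2 ^ d / 4)) ^ S.card) := by
    calc F = ∑ f : Fin (2 ^ n) → Fin (2 ^ d) → Fin (2 ^ m), (1 : ℝ) := by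
          rw [Finset.sum_const, nsmul_eq_mul, mul_one, Finset.card_univ]
      _ ≤ ∑ f, ∑ S : Finset (Fin (2 ^ n)) with 2 ^ k ≤ S.card, ∑ Y, w f S Y :=
          Finset.sum_le_sum fun f _ => hlow f
      _ = ∑ S : Finset (Fin (2 ^ n)) with 2 ^ k ≤ S.card, ∑ Y, ∑ f, w f S Y := by
          rw [Finset.sum_comm]
          exact Finset.sum_congr rfl fun S _ => Finset.sum_comm
      _ ≤ ∑ S : Finset (Fin (2 ^ n)) with 2 ^ k ≤ S.card, ∑ _Y : Finset (Fin (2 ^ m)),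
            F * (2 * Real.exp (-(ε ^ 2 * 2 ^ d / 4)) ^ S.card) :=
          Finset.sum_le_sum fun S _ => Finset.sum_le_sum fun Y _ => hup S Y
      _ = _ := by
          simp only [Finset.sum_const, Finset.card_univ, Fintype.card_finset, Fintype.card_fin,
            nsmul_eq_mul, Finset.mul_sum]
          refine Finset.sum_congr rfl fun S _ => ?_
          push_cast
          ring
  nlinarith

/-- With error larger than `1` every graph is an extractor. -/
lemma isExtractor_of_one_lt {n m d : ℕ} (nbr : Fin (2 ^ n) → Fin (2 ^ d) → Fin (2 ^ m))
    (k : ℕ) {ε : ℝ} (hε : 1 < ε) : IsExtractor nbr k ε := by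
  intro S _ Y
  have hedges : (edges nbr S Y : ℝ) ≤ (2 ^ d : ℕ) * S.card := by
    have h : edges nbr S Y ≤ S.card * 2 ^ d := by
      refine Finset.sum_le_card_nsmul _ _ _ fun x _ => ?_
      exact (Finset.card_le_univ _).trans (Fintype.card_fin _).le
    rw [mul_comm]
    exact_mod_cast h
  have hY : (Y.card : ℝ) ≤ (2 ^ m : ℕ) := by
    have h := Finset.card_le_univ Y
    rw [Fintype.card_fin] at h
    exact_mod_cast h
  have h1 := div_le_one_of_le₀ hedges (by positivity)
  have h2 := div_le_one_of_le₀ hY (by positivity)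
  have h3 : 0 ≤ (edges nbr S Y : ℝ) / ((2 ^ d : ℕ) * S.card) := by positivity
  have h4 : 0 ≤ (Y.card : ℝ) / (2 ^ m : ℕ) := by positivity
  rw [abs_lt]
  constructor <;> linarith

lemma two_pow_le_exp (a : ℕ) : (2 : ℝ) ^ a ≤ Real.exp a := by
  have h := Real.add_one_le_exp (1 : ℝ)
  calc (2 : ℝ) ^ a ≤ Real.exp 1 ^ a := by gcongr; linarith
    _ = Real.exp a := by rw [← Real.exp_nat_mul, mul_one]

/-- The total failure weight is below `1` when `ε² · 2 ^ d` dominates `n - k` and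
`2 ^ (m - k)`. -/
lemma two_mul_sum_exp_pow_card_lt_one {n m k : ℕ} (hkn : k < n) {A : ℝ}
    (hA : 32 * ((n : ℝ) - k) ≤ A) (hm : 32 * (2 : ℝ) ^ m ≤ 2 ^ k * A) :
    (2 : ℝ) ^ (2 ^ m) * 2 * ∑ S : Finset (Fin (2 ^ n)) with 2 ^ k ≤ S.card,
      Real.exp (-(A / 4)) ^ S.card < 1 := by
  obtain ⟨r, rfl⟩ := Nat.exists_eq_add_of_lt hkn
  set q : ℕ := r + 1 with hq
  have hq1 : (1 : ℝ) ≤ q := by rw [hq]; push_cast; linarith [Nat.cast_nonneg (α := ℝ) r]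
  have hAq : 32 * (q : ℝ) ≤ A := by
    rw [hq]
    push_cast at hA ⊢
    linarith
  have hK : (1 : ℝ) ≤ 2 ^ k := one_le_pow₀ (by norm_num)
  have hS := sum_pow_card_le (ι := Fin (2 ^ (k + r + 1))) (Real.exp_pos (-(A / 4))).le
    (t := Real.exp (A / 4 - q)) (Real.one_le_exp (by linarith)) (2 ^ k)
  have hN : Real.exp (-(A / 4)) * Real.exp (A / 4 - q) *
      Fintype.card (Fin (2 ^ (k + r + 1))) ≤ 2 ^ k := by
    rw [← Real.exp_add, Fintype.card_fin, add_assoc, ← hq, pow_add]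
    push_cast
    have h := mul_le_mul_of_nonneg_left (two_pow_le_exp q) (Real.exp_pos (-(q : ℝ))).le
    rw [← Real.exp_add, neg_add_cancel, Real.exp_zero] at h
    have he : -(A / 4) + (A / 4 - q) = -(q : ℝ) := by ring
    rw [he]
    nlinarith
  have hM := two_pow_le_exp (2 ^ m)
  push_cast at hM
  have h2 : (2 : ℝ) ≤ Real.exp 1 := by linarith [Real.add_one_le_exp (1 : ℝ)]
  calc _ ≤ Real.exp (2 ^ m) * Real.exp 1 *
        (Real.exp (2 ^ k) / Real.exp (A / 4 - q) ^ (2 ^ k)) := by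
        gcongr
        exact hS.trans (by gcongr)
    _ = Real.exp (2 ^ m + 1 + (2 ^ k - 2 ^ k * (A / 4 - q))) := by
        rw [← Real.exp_nat_mul, ← Real.exp_sub, ← Real.exp_add, ← Real.exp_add]
        push_cast
        rfl
    _ < 1 := by
        rw [Real.exp_lt_one_iff]
        nlinarith [mul_le_mul_of_nonneg_left hAq (zero_le_one.trans hK),
          mul_le_mul_of_nonneg_left hq1 (zero_le_one.trans hK)]

/-- probabilistic existence of extractors: there is an absolute
constant `c` such that for all `n`, `k < n` and `ε > 0`, and all parameters
`d ≥ log(n−k) + 2·log(1/ε) + c` and `m ≤ k + d − 2·log(1/ε) − c`, there exists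
a `(k, ε)`-extractor with parameters `(n, m, d)`. -/
theorem stmt_8 :
    ∃ c : ℝ, 0 < c ∧
      ∀ n k : ℕ, k < n → ∀ ε : ℝ, 0 < ε →
        ∀ d m : ℕ,
          Real.logb 2 ((n : ℝ) - k) + 2 * Real.logb 2 (1 / ε) + c ≤ (d : ℝ) →
          (m : ℝ) ≤ (k : ℝ) + d - 2 * Real.logb 2 (1 / ε) - c →
          ∃ nbr : Fin (2^n) → Fin (2^d) → Fin (2^m), IsExtractor nbr k ε := by
  refine ⟨5, by norm_num, fun n k hkn ε hε d m hd hm => ?_⟩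
  rcases lt_or_ge 1 ε with hε1 | hε1
  · exact ⟨fun _ _ => 0, isExtractor_of_one_lt _ k hε1⟩
  have hnk : (0 : ℝ) < (n : ℝ) - k := sub_pos.mpr (by exact_mod_cast hkn)
  have hlog : 2 * Real.logb 2 (1 / ε) = -Real.logb 2 (ε ^ 2) := by
    rw [one_div, Real.logb_inv, Real.logb_pow]
    push_cast
    ring
  have hpow : ∀ a : ℕ, Real.logb 2 ((2 : ℝ) ^ a) = a := fun a => by
    rw [Real.logb_pow, Real.logb_self_eq_one (by norm_num), mul_one]
  have h32 : Real.logb 2 32 = 5 := by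
    rw [show (32 : ℝ) = 2 ^ 5 by norm_num, hpow]
    norm_num
  have hA : Real.logb 2 (ε ^ 2 * 2 ^ d) = Real.logb 2 (ε ^ 2) + d := by
    rw [Real.logb_mul (by positivity) (by positivity), hpow]
  refine exists_isExtractor_of_sum_lt_one hε hε1 (two_mul_sum_exp_pow_card_lt_one hkn ?_ ?_)
  · rw [← Real.logb_le_logb (b := 2) (by norm_num) (by positivity) (by positivity),
      Real.logb_mul (by norm_num) hnk.ne', hA, h32]
    linarith
  · rw [← Real.logb_le_logb (b := 2) (by norm_num) (by positivity) (by positivity),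
      Real.logb_mul (by norm_num) (by positivity), Real.logb_mul (by positivity) (by positivity),
      hA, h32, hpow, hpow]
    linarith
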